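/- The triple (Cof, Fib, W) = (Iso ∪ NonEmpty, Iso ∪ Empty, All) is a model structure on the category Set of sets: the cofibrations are the set maps that are bijections or have nonempty domain, the fibrations are the set maps that are bijections or have empty domain, and every set map is a weak equivalence. -/

import Mathlib

universe u

/-- A class of morphisms of the category `Set` of sets. -/
abbrev MapClass : Type (u + 1) := ∀ (X Y : Type u), (X → Y) → Prop

/-- `i` has the left lifting property (LLP) with respect to `p`
(equivalently, `p` has the right lifting property (RLP) with respect to `i`):
every commutative square `p ∘ α = β ∘ i` admits a diagonal filler `g`. -/
def LiftSq {A B X Y : Type u} (i : A → B) (p : X → Y) : Prop :=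
  ∀ (α : A → X) (β : B → Y), p ∘ α = β ∘ i →
    ∃ g : B → X, g ∘ i = α ∧ p ∘ g = β

/-- `All`: the class of all set maps. -/
def AllMaps : MapClass.{u} := fun _ _ _ => True

/-- `Iso`: the class of bijections. -/
def IsoMaps : MapClass.{u} := fun _ _ f => Function.Bijective f

/-- `Mono`: the class of injections. -/
def MonoMaps : MapClass.{u} := fun _ _ f => Function.Injective f

/-- `Epi`: the class of surjections. -/
def EpiMaps : MapClass.{u} := fun _ _ f => Function.Surjective f

/-- `SplitMono`: the class of set maps having a left inverse. -/
def SplitMonoMaps : MapClass.{u} := fun X Y f => ∃ g : Y → X, g ∘ f = id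

/-- `Empty`: the class of set maps whose domain is empty. -/
def EmptyMaps : MapClass.{u} := fun X _Y _f => IsEmpty X

/-- `NonEmpty`: the class of set maps whose domain is nonempty. -/
def NonEmptyMaps : MapClass.{u} := fun X _Y _f => Nonempty X

/-- The union of two classes of set maps. -/
def unionMaps (P Q : MapClass.{u}) : MapClass.{u} := fun X Y f => P X Y f ∨ Q X Y f

/-- `(L, R)` is a weak factorization system on the category of sets:
`L` is exactly the class of maps having the LLP with respect to every member of `R`,
`R` is exactly the class of maps having the RLP with respect to every member of `L`,
and every set map factors as `r ∘ l` with `l ∈ L` and `r ∈ R`. -/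
structure IsWFS (L R : MapClass.{u}) : Prop where
  left_iff : ∀ {A B : Type u} (i : A → B),
    L A B i ↔ ∀ {X Y : Type u} (p : X → Y), R X Y p → LiftSq i p
  right_iff : ∀ {X Y : Type u} (p : X → Y),
    R X Y p ↔ ∀ {A B : Type u} (i : A → B), L A B i → LiftSq i p
  factor : ∀ {X Y : Type u} (f : X → Y),
    ∃ (Z : Type u) (l : X → Z) (r : Z → Y), L X Z l ∧ R Z Y r ∧ r ∘ l = f

/-- `f` is a retract of `g` in the arrow category of `Set`. -/
def IsRetract {X Y Z W : Type u} (f : X → Y) (g : Z → W) : Prop :=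
  ∃ (i : X → Z) (p : Z → X) (j : Y → W) (q : W → Y),
    p ∘ i = id ∧ q ∘ j = id ∧ g ∘ i = j ∘ f ∧ q ∘ g = f ∘ p

/-- `(Cof, Fib, W)` is a model structure on the category of sets: `W` is closed under
retracts and satisfies the two-out-of-three axiom, and both `(Cof ∩ W, Fib)` and
`(Cof, Fib ∩ W)` are weak factorization systems. -/
structure IsModelStructure (Cof Fib W : MapClass.{u}) : Prop where
  weq_retract : ∀ {X Y Z T : Type u} (f : X → Y) (g : Z → T),
    IsRetract f g → W Z T g → W X Y f
  weq_comp : ∀ {X Y Z : Type u} (f : X → Y) (g : Y → Z),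
    W X Y f → W Y Z g → W X Z (g ∘ f)
  weq_of_comp_left : ∀ {X Y Z : Type u} (f : X → Y) (g : Y → Z),
    W X Y f → W X Z (g ∘ f) → W Y Z g
  weq_of_comp_right : ∀ {X Y Z : Type u} (f : X → Y) (g : Y → Z),
    W Y Z g → W X Z (g ∘ f) → W X Y f
  wfs_trivCof_fib : IsWFS (fun X Y f => Cof X Y f ∧ W X Y f) Fib
  wfs_cof_trivFib : IsWFS Cof (fun X Y f => Fib X Y f ∧ W X Y f)

theorem liftSq_of_bijective_left {A B X Y : Type u} {i : A → B} (hi : Function.Bijective i)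
    (p : X → Y) : LiftSq i p := by
  intro α β h
  let e := Equiv.ofBijective i hi
  have hl : e.symm ∘ i = id := funext e.symm_apply_apply
  have hr : i ∘ e.symm = id := funext e.apply_symm_apply
  refine ⟨α ∘ e.symm, ?_, ?_⟩
  · rw [Function.comp_assoc, hl, Function.comp_id]
  · rw [← Function.comp_assoc, h, Function.comp_assoc, hr, Function.comp_id]

theorem liftSq_of_bijective_right {A B X Y : Type u} (i : A → B) {p : X → Y}
    (hp : Function.Bijective p) : LiftSq i p := by
  intro α β h
  let e := Equiv.ofBijective p hp
  have hl : e.symm ∘ p = id := funext e.symm_apply_apply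
  have hr : p ∘ e.symm = id := funext e.apply_symm_apply
  refine ⟨e.symm ∘ β, ?_, ?_⟩
  · rw [Function.comp_assoc, ← h, ← Function.comp_assoc, hl, Function.id_comp]
  · rw [← Function.comp_assoc, hr, Function.id_comp]

/-- A map lifting against itself is a bijection. -/
theorem LiftSq.bijective {X Y : Type u} {f : X → Y} (h : LiftSq f f) : Function.Bijective f := by
  obtain ⟨g, hl, hr⟩ := h id id rfl
  exact Function.bijective_iff_has_inverse.mpr ⟨g, congrFun hl, congrFun hr⟩

theorem liftSq_of_isoOrNonEmpty_of_isoOrEmpty {A B X Y : Type u} {i : A → B} {p : X → Y}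
    (hi : unionMaps IsoMaps NonEmptyMaps A B i) (hp : unionMaps IsoMaps EmptyMaps X Y p) :
    LiftSq i p := by
  rcases hi with hi | ⟨⟨a⟩⟩
  · exact liftSq_of_bijective_left hi p
  rcases hp with hp | hp
  · exact liftSq_of_bijective_right i hp
  · exact fun α _ _ => (hp.false (α a)).elim

theorem isWFS_isoOrNonEmpty_isoOrEmpty :
    IsWFS.{u} (unionMaps IsoMaps NonEmptyMaps) (unionMaps IsoMaps EmptyMaps) where
  left_iff {A _} i := by
    refine ⟨fun hi _ _ _ hp => liftSq_of_isoOrNonEmpty_of_isoOrEmpty hi hp, fun h => ?_⟩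
    rcases isEmpty_or_nonempty A with hA | hA
    · exact .inl (h i (.inr hA)).bijective
    · exact .inr hA
  right_iff {X _} p := by
    refine ⟨fun hp _ _ _ hi => liftSq_of_isoOrNonEmpty_of_isoOrEmpty hi hp, fun h => ?_⟩
    rcases isEmpty_or_nonempty X with hX | hX
    · exact .inr hX
    · exact .inl (h p (.inr hX)).bijective
  factor {X Y} f := by
    rcases isEmpty_or_nonempty X with hX | hX
    · exact ⟨X, id, f, .inl Function.bijective_id, .inr hX, rfl⟩
    · exact ⟨Y, f, id, .inr hX, .inl Function.bijective_id, rfl⟩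

/-- The triple `(Iso ∪ NonEmpty, Iso ∪ Empty, All)` is a model structure on the category of sets. -/
theorem isoOrNonEmpty_isoOrEmpty_all_isModelStructure :
    IsModelStructure.{u} (unionMaps IsoMaps NonEmptyMaps) (unionMaps IsoMaps EmptyMaps) (AllMaps) := by
  have inter_all (P : MapClass.{u}) : (fun X Y f => P X Y f ∧ AllMaps X Y f) = P := by
    funext X Y f
    exact and_true _
  refine ⟨fun _ _ _ _ => trivial, fun _ _ _ _ => trivial, fun _ _ _ _ => trivial,
    fun _ _ _ _ => trivial, ?_, ?_⟩
  · rw [inter_all]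
    exact isWFS_isoOrNonEmpty_isoOrEmpty
  · rw [inter_all]
    exact isWFS_isoOrNonEmpty_isoOrEmpty
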